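/- Let W be a confocal linear family of bisectors with negative common focus: there is f₀ ∈ V with ⟨f₀,f₀⟩ < 0 and h f₀ = 0 for all h ∈ W. Then dim_ℝ W ≤ 4; and if dim_ℝ W ≥ 3 then the base of W reduces to the focus: {[v] ∈ ℙ(V) | ⟨h v, v⟩ = 0 for all h ∈ W} = {[f₀]}. -/

import Mathlib

open scoped ComplexConjugate

noncomputable section

/-- `V` is `ℂ³`. -/
abbrev V3 : Type := Fin 3 → ℂ

/-- The hermitian form of signature `(2,1)`:
`⟨x,y⟩ = x₀·conj y₀ + x₁·conj y₁ − x₂·conj y₂`. -/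
def herm (x y : V3) : ℂ := x 0 * conj (y 0) + x 1 * conj (y 1) - x 2 * conj (y 2)

/-- The complex projective plane `ℙ(V)`. -/
abbrev PV : Type := Projectivization ℂ V3

/-- The class `[v]` of a nonzero vector `v` in `ℙ(V)`. -/
def projMk (v : V3) (hv : v ≠ 0) : PV := Projectivization.mk ℂ v hv

/-- A map `h` is self-adjoint (`h* = h`) w.r.t. the hermitian form. -/
def SelfAdj (h : Module.End ℂ V3) : Prop := ∀ x y : V3, herm (h x) y = herm x (h y)

/-- The set `B_h = {[v] ∈ ℙ(V) | ⟨h v, v⟩ = 0}`. -/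
def Bset (h : Module.End ℂ V3) : Set PV :=
  {q | ∃ v : V3, ∃ hv : v ≠ 0, q = projMk v hv ∧ herm (h v) v = 0}

/-- `h` defines a bisector: self-adjoint, trace `0`, rank `2`, and `B_h` contains
a point other than the focus (i.e. a point `[v]` with `h v ≠ 0`). -/
def IsBisector (h : Module.End ℂ V3) : Prop :=
  SelfAdj h ∧ LinearMap.trace ℂ V3 h = 0 ∧
    Module.finrank ℂ (LinearMap.range h) = 2 ∧ ∃ v : V3, herm (h v) v = 0 ∧ h v ≠ 0

/-- A linear family of bisectors: an `ℝ`-subspace of self-adjoint traceless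
degenerate maps whose base contains a negative point. -/
def IsLinearFamily (W : Submodule ℝ (Module.End ℂ V3)) : Prop :=
  (∀ h ∈ W, SelfAdj h ∧ LinearMap.trace ℂ V3 h = 0 ∧ LinearMap.det h = 0) ∧
    ∃ v : V3, ∃ hv : v ≠ 0, (herm v v).re < 0 ∧ ∀ h ∈ W, herm (h v) v = 0

/-- The map `x ↦ ⟨x,p⟩·p`. -/
def wmap (p : V3) : Module.End ℂ V3 where
  toFun x := herm x p • p
  map_add' x y := by
    show herm (x + y) p • p = herm x p • p + herm y p • p
    have : herm (x + y) p = herm x p + herm y p := by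
      simp only [herm, Pi.add_apply]; ring
    rw [this, add_smul]
  map_smul' c x := by
    show herm (c • x) p • p = c • (herm x p • p)
    have : herm (c • x) p = c * herm x p := by
      simp only [herm, Pi.smul_apply, smul_eq_mul]; ring
    rw [this, mul_smul]

/-- `ℙ(U)` for a complex subspace `U`. -/
def projC (U : Submodule ℂ V3) : Set PV :=
  {q | ∃ v : V3, ∃ hv : v ≠ 0, v ∈ U ∧ q = projMk v hv}

/-- `ℙ(T)` for a real subspace `T`. -/
def projR (T : Submodule ℝ V3) : Set PV :=
  {q | ∃ v : V3, ∃ hv : v ≠ 0, v ∈ T ∧ q = projMk v hv}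

/-- An `ℝ`-plane: `ℙ(T)` for a totally real `3`-dimensional real subspace `T`
with `ℂ·T = V`. -/
def IsRealPlane (T : Submodule ℝ V3) : Prop :=
  Module.finrank ℝ T = 3 ∧ Submodule.span ℂ (T : Set V3) = ⊤ ∧
    ∀ t ∈ T, ∀ t' ∈ T, (herm t t').im = 0

/-- A geodesic: `ℙ(W₀)` for a `2`-dimensional real subspace `W₀` on which the form
is real-valued and not identically zero. -/
def IsGeodesic (W₀ : Submodule ℝ V3) : Prop :=
  Module.finrank ℝ W₀ = 2 ∧ (∀ w ∈ W₀, ∀ w' ∈ W₀, (herm w w').im = 0) ∧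
    ∃ w ∈ W₀, ∃ w' ∈ W₀, herm w w' ≠ 0

/-- The real spine `R = {[h v] | [v] ∈ B_h, h v ≠ 0}` of `B_h`. -/
def RealSpine (h : Module.End ℂ V3) : Set PV :=
  {q | ∃ v : V3, ∃ hnz : h v ≠ 0, herm (h v) v = 0 ∧ q = projMk (h v) hnz}

/-- The orthogonal complement w.r.t. the hermitian form. -/
def hermOrth (U : Submodule ℂ V3) : Submodule ℂ V3 where
  carrier := {x | ∀ u ∈ U, herm x u = 0}
  add_mem' := by
    intro a b ha hb u hu
    have h1 : herm (a + b) u = herm a u + herm b u := by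
      simp only [herm, Pi.add_apply]; ring
    rw [h1, ha u hu, hb u hu, add_zero]
  zero_mem' := by
    intro u hu
    simp [herm]
  smul_mem' := by
    intro c x hx u hu
    have h1 : herm (c • x) u = c * herm x u := by
      simp only [herm, Pi.smul_apply, smul_eq_mul]; ring
    rw [h1, hx u hu, mul_zero]


/-- The linear functional `x ↦ ⟨x,y⟩`. -/
def hermRight (y : V3) : V3 →ₗ[ℂ] ℂ where
  toFun x := herm x y
  map_add' a b := by simp only [herm, Pi.add_apply]; ring
  map_smul' c a := by simp only [herm, Pi.smul_apply, smul_eq_mul, RingHom.id_apply]; ring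

theorem hermRight_apply (x y : V3) : hermRight y x = herm x y := rfl

theorem herm_zero_right (x : V3) : herm x 0 = 0 := by simp [herm]

theorem herm_conj (x y : V3) : conj (herm x y) = herm y x := by
  simp only [herm, map_add, map_sub, map_mul, Complex.conj_conj]; ring

theorem herm_eq_zero_comm {x y : V3} (h : herm x y = 0) : herm y x = 0 := by
  rw [← herm_conj, h, map_zero]

theorem herm_sub_smul_left (x z y : V3) (c : ℂ) :
    herm (x - c • z) y = herm x y - c * herm z y := by
  simp only [herm, Pi.sub_apply, Pi.smul_apply, smul_eq_mul]; ring

theorem herm_sub_smul_right (x y z : V3) (c : ℂ) :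
    herm x (y - c • z) = herm x y - conj c * herm x z := by
  simp only [herm, Pi.sub_apply, Pi.smul_apply, smul_eq_mul, map_sub, map_mul]; ring

/-- The form is definite on the orthogonal complement of a negative vector. -/
theorem herm_self_ne_zero_of_orthogonal {f p : V3} (hf : (herm f f).re < 0)
    (hpf : herm p f = 0) (hp : p ≠ 0) : herm p p ≠ 0 := by
  intro h0
  have hlag : herm p p * (f 2 * conj (f 2)) =
      -(p 0 * conj (p 0) + p 1 * conj (p 1)) * herm f f
        + (p 0 * f 1 - p 1 * f 0) * conj (p 0 * f 1 - p 1 * f 0)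
        - (herm p f * conj (herm p f) - herm p f * conj (p 0 * conj (f 0) + p 1 * conj (f 1))
          - conj (herm p f) * (p 0 * conj (f 0) + p 1 * conj (f 1))) := by
    simp only [herm, map_add, map_sub, map_mul, Complex.conj_conj]; ring
  have hff : herm f f = ((Complex.normSq (f 0) + Complex.normSq (f 1)
      - Complex.normSq (f 2) : ℝ) : ℂ) := by
    simp only [herm, Complex.mul_conj]; push_cast; ring
  rw [h0, hpf, hff] at hlag
  rw [hff, Complex.ofReal_re] at hf
  simp only [Complex.mul_conj, zero_mul, map_zero, sub_zero, mul_zero] at hlag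
  norm_cast at hlag
  have n0 := Complex.normSq_nonneg (p 0)
  have n1 := Complex.normSq_nonneg (p 1)
  have n2 := Complex.normSq_nonneg (p 0 * f 1 - p 1 * f 0)
  have hsum : Complex.normSq (p 0) + Complex.normSq (p 1) = 0 := by
    by_contra hne
    have hpos : 0 < Complex.normSq (p 0) + Complex.normSq (p 1) := by positivity
    nlinarith [mul_neg_of_pos_of_neg hpos hf]
  have h0' : p 0 = 0 := Complex.normSq_eq_zero.1 (by linarith)
  have h1' : p 1 = 0 := Complex.normSq_eq_zero.1 (by linarith)
  have h2' : p 2 = 0 := by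
    simpa [herm, h0', h1'] using h0
  exact hp (by ext i; fin_cases i <;> simp [h0', h1', h2'])

/-- The vector dual to `x ↦ det (x, p, f)` with respect to the form. -/
def hermCross (p f : V3) : V3 :=
  ![conj (p 1 * f 2 - p 2 * f 1), conj (p 2 * f 0 - p 0 * f 2), -conj (p 0 * f 1 - p 1 * f 0)]

theorem herm_hermCross_left (p f : V3) : herm p (hermCross p f) = 0 := by
  simp [herm, hermCross]; ring

theorem herm_hermCross_right (p f : V3) : herm f (hermCross p f) = 0 := by
  simp [herm, hermCross]; ring

theorem herm_hermCross_self (p f : V3) : herm (hermCross p f) (hermCross p f) =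
    herm p f * herm f p - herm p p * herm f f := by
  simp [herm, hermCross]; ring

section OrthogonalBasis

variable {b : Fin 3 → V3}

theorem linearIndependent_of_orthogonal (hn : ∀ i, herm (b i) (b i) ≠ 0)
    (ho : ∀ i j, i ≠ j → herm (b i) (b j) = 0) : LinearIndependent ℂ b := by
  rw [Fintype.linearIndependent_iff]
  intro g hg j
  have h := congrArg (hermRight (b j)) hg
  rw [map_sum, map_zero, Finset.sum_eq_single j] at h
  · simpa [hermRight_apply, hn j] using h
  · intro i _ hij
    simp [hermRight_apply, ho i j hij]
  · simp

/-- The basis given by an orthogonal triple of nonisotropic vectors. -/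
def orthogonalBasis (hn : ∀ i, herm (b i) (b i) ≠ 0)
    (ho : ∀ i j, i ≠ j → herm (b i) (b j) = 0) : Module.Basis (Fin 3) ℂ V3 :=
  basisOfLinearIndependentOfCardEqFinrank (linearIndependent_of_orthogonal hn ho) (by simp)

theorem orthogonalBasis_apply (hn : ∀ i, herm (b i) (b i) ≠ 0)
    (ho : ∀ i j, i ≠ j → herm (b i) (b j) = 0) (i : Fin 3) :
    orthogonalBasis hn ho i = b i := by
  simp [orthogonalBasis]

theorem herm_eq_repr_mul (hn : ∀ i, herm (b i) (b i) ≠ 0)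
    (ho : ∀ i j, i ≠ j → herm (b i) (b j) = 0) (x : V3) (j : Fin 3) :
    herm x (b j) = (orthogonalBasis hn ho).repr x j * herm (b j) (b j) := by
  conv_lhs => rw [← (orthogonalBasis hn ho).sum_repr x]
  rw [← hermRight_apply, map_sum, Finset.sum_eq_single j]
  · simp [hermRight_apply, orthogonalBasis_apply]
  · intro i _ hij
    simp [hermRight_apply, orthogonalBasis_apply, ho i j hij]
  · simp

theorem eq_zero_of_herm_eq_zero (hn : ∀ i, herm (b i) (b i) ≠ 0)
    (ho : ∀ i j, i ≠ j → herm (b i) (b j) = 0) {x : V3} (hx : ∀ j, herm x (b j) = 0) :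
    x = 0 := by
  apply (orthogonalBasis hn ho).repr.map_eq_zero_iff.1
  ext j
  have h := herm_eq_repr_mul hn ho x j
  rw [hx j] at h
  exact (mul_eq_zero.1 h.symm).resolve_right (hn j)

end OrthogonalBasis

/-- A traceless self-adjoint map killing `f` is determined by `⟨h p, p⟩` and `⟨h p, q⟩`, for an
orthogonal triple `f, p, q` of nonisotropic vectors. -/
theorem SelfAdj.eq_zero {h : Module.End ℂ V3} (hs : SelfAdj h)
    (htr : LinearMap.trace ℂ V3 h = 0) {f p q : V3} (hff : herm f f ≠ 0) (hpp : herm p p ≠ 0)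
    (hqq : herm q q ≠ 0) (hpf : herm p f = 0) (hpq : herm p q = 0) (hfq : herm f q = 0)
    (hf : h f = 0) (h1 : herm (h p) p = 0) (h2 : herm (h p) q = 0) : h = 0 := by
  have hn : ∀ i, herm (![f, p, q] i) (![f, p, q] i) ≠ 0 := by
    intro i; fin_cases i <;> simpa
  have ho : ∀ i j, i ≠ j → herm (![f, p, q] i) (![f, p, q] j) = 0 := by
    have hfp := herm_eq_zero_comm hpf
    have hqp := herm_eq_zero_comm hpq
    have hqf := herm_eq_zero_comm hfq
    intro i j hij
    fin_cases i <;> fin_cases j <;> first | exact absurd rfl hij | simpa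
  have hp : h p = 0 := by
    apply eq_zero_of_herm_eq_zero hn ho
    intro j
    fin_cases j
    · simp [hs p f, hf, herm_zero_right]
    · simpa using h1
    · simpa using h2
  have hB := orthogonalBasis_apply hn ho
  rw [LinearMap.trace_eq_matrix_trace ℂ (orthogonalBasis hn ho), Matrix.trace_fin_three] at htr
  simp only [LinearMap.toMatrix_apply, hB] at htr
  simp only [Matrix.cons_val, hf, hp, map_zero, Finsupp.zero_apply, zero_add] at htr
  have hq : h q = 0 := by
    apply eq_zero_of_herm_eq_zero hn ho
    intro j
    fin_cases j
    · simp [hs q f, hf, herm_zero_right]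
    · simp [hs q p, hp, herm_zero_right]
    · simpa [htr] using herm_eq_repr_mul hn ho (h q) 2
  refine (orthogonalBasis hn ho).ext fun i => ?_
  rw [hB]
  fin_cases i <;> simpa

/-- The real-linear map `h ↦ ⟨h p, q⟩`. -/
def hermEntry (p q : V3) : Module.End ℂ V3 →ₗ[ℝ] ℂ :=
  (hermRight q ∘ₗ LinearMap.applyₗ p).restrictScalars ℝ

theorem Submodule.finrank_le_of_map_eq_zero {M E : Type*} [AddCommGroup M] [Module ℝ M]
    [AddCommGroup E] [Module ℝ E] [FiniteDimensional ℝ E] (W : Submodule ℝ M) (φ : M →ₗ[ℝ] E)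
    (hφ : ∀ h ∈ W, φ h = 0 → h = 0) : Module.finrank ℝ W ≤ Module.finrank ℝ E :=
  LinearMap.finrank_le_finrank_of_injective (f := φ.domRestrict W) <|
    (injective_iff_map_eq_zero (φ.domRestrict W)).2 fun h hh => Subtype.ext (hφ h h.2 hh)

/-- Confocal traceless self-adjoint maps embed into `ℂ × ℂ`. -/
theorem finrank_le_four {W : Submodule ℝ (Module.End ℂ V3)}
    (hW : ∀ h ∈ W, SelfAdj h ∧ LinearMap.trace ℂ V3 h = 0) {f p q : V3} (hff : herm f f ≠ 0)
    (hpp : herm p p ≠ 0) (hqq : herm q q ≠ 0) (hpf : herm p f = 0) (hpq : herm p q = 0)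
    (hfq : herm f q = 0) (hf : ∀ h ∈ W, h f = 0) : Module.finrank ℝ W ≤ 4 := by
  have h4 := W.finrank_le_of_map_eq_zero ((hermEntry p p).prod (hermEntry p q)) fun h hh h0 =>
    (hW h hh).1.eq_zero (hW h hh).2 hff hpp hqq hpf hpq hfq (hf h hh) (congrArg Prod.fst h0)
      (congrArg Prod.snd h0)
  simpa using h4

/-- If in addition `p` is in the base, the family embeds into `ℂ`. -/
theorem finrank_le_two {W : Submodule ℝ (Module.End ℂ V3)}
    (hW : ∀ h ∈ W, SelfAdj h ∧ LinearMap.trace ℂ V3 h = 0) {f p q : V3} (hff : herm f f ≠ 0)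
    (hpp : herm p p ≠ 0) (hqq : herm q q ≠ 0) (hpf : herm p f = 0) (hpq : herm p q = 0)
    (hfq : herm f q = 0) (hf : ∀ h ∈ W, h f = 0) (hp : ∀ h ∈ W, herm (h p) p = 0) :
    Module.finrank ℝ W ≤ 2 := by
  have h2 := W.finrank_le_of_map_eq_zero (hermEntry p q) fun h hh h0 =>
    (hW h hh).1.eq_zero (hW h hh).2 hff hpp hqq hpf hpq hfq (hf h hh) (hp h hh) h0
  simpa using h2

/-- Remark 4.3.4: a confocal linear family of bisectors with negative
common focus has dimension at most `4`, and if the dimension is at least `3` the base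
reduces to the focus. -/
theorem stmt_11 (W : Submodule ℝ (Module.End ℂ V3)) (hW : IsLinearFamily W)
    (f₀ : V3) (hf0 : f₀ ≠ 0) (hsig : (herm f₀ f₀).re < 0)
    (hconf : ∀ h ∈ W, h f₀ = 0) :
    Module.finrank ℝ W ≤ 4 ∧
      (3 ≤ Module.finrank ℝ W →
        {q : PV | ∃ v : V3, ∃ hv : v ≠ 0, q = projMk v hv ∧ ∀ h ∈ W, herm (h v) v = 0}
          = {projMk f₀ hf0}) := by
  have hff : herm f₀ f₀ ≠ 0 := fun h => by simp [h] at hsig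
  have hW' : ∀ h ∈ W, SelfAdj h ∧ LinearMap.trace ℂ V3 h = 0 := fun h hh =>
    ⟨(hW.1 h hh).1, (hW.1 h hh).2.1⟩
  have hcross : ∀ p : V3, herm p f₀ = 0 → herm p p ≠ 0 →
      herm (hermCross p f₀) (hermCross p f₀) ≠ 0 := fun p hpf hpp => by
    rw [herm_hermCross_self, hpf, zero_mul, zero_sub]
    exact neg_ne_zero.2 (mul_ne_zero hpp hff)
  constructor
  · have hf2 : f₀ 2 ≠ 0 := by
      intro h2
      simp only [herm, h2, Complex.mul_conj, zero_mul, sub_zero, Complex.add_re,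
        Complex.ofReal_re] at hsig
      linarith [Complex.normSq_nonneg (f₀ 0), Complex.normSq_nonneg (f₀ 1)]
    let p : V3 := ![conj (f₀ 2), 0, conj (f₀ 0)]
    have hpf : herm p f₀ = 0 := by simp [p, herm]; ring
    have hp : p ≠ 0 := fun h => hf2 (by simpa [p] using congrFun h 0)
    have hpp := herm_self_ne_zero_of_orthogonal hsig hpf hp
    exact finrank_le_four hW' hff hpp (hcross p hpf hpp) hpf (herm_hermCross_left p f₀)
      (herm_hermCross_right p f₀) hconf
  · intro hdim
    ext x
    simp only [Set.mem_ofPred_eq, Set.mem_singleton_iff]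
    constructor
    · rintro ⟨v, hv, rfl, hbase⟩
      set s : ℂ := herm v f₀ / herm f₀ f₀
      have hpf : herm (v - s • f₀) f₀ = 0 := by
        rw [herm_sub_smul_left, div_mul_cancel₀ _ hff, sub_self]
      have hp0 : v - s • f₀ = 0 := by
        by_contra hp
        have hpp := herm_self_ne_zero_of_orthogonal hsig hpf hp
        have hpW : ∀ h ∈ W, herm (h (v - s • f₀)) (v - s • f₀) = 0 := fun h hh => by
          rw [map_sub, map_smul, hconf h hh, smul_zero, sub_zero, herm_sub_smul_right,
            hbase h hh, (hW' h hh).1, hconf h hh, herm_zero_right, mul_zero, sub_zero]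
        have := finrank_le_two hW' hff hpp (hcross _ hpf hpp) hpf (herm_hermCross_left _ f₀)
          (herm_hermCross_right _ f₀) hconf hpW
        omega
      exact (Projectivization.mk_eq_mk_iff' ℂ v f₀ hv hf0).2 ⟨s, (sub_eq_zero.1 hp0).symm⟩
    · rintro rfl
      exact ⟨f₀, hf0, rfl, fun h hh => by simp [hconf h hh, herm]⟩

end
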